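/- arXiv:1905.02740 — 2 statements merged into one kernel-verified Lean document; each statement's English description precedes it below -/
import Mathlib

section
/- Let G be an amenable group and let X be a compact Hausdorff space equipped with a continuous action of G. Suppose that the action is expansive and has the weak specification property (with respect to the unique uniform structure on X compatible with its topology). Then every pre-injective continuous G-equivariant map f : X → X is surjective. -/
open scoped Pointwise Uniformity
open Filter

/-- A left Følner net for a group `G`: a net, indexed by a nonempty directed set `J`,
of nonempty finite subsets `F j ⊆ G` such that `|g F_j \ F_j| / |F_j| → 0` for every `g`. -/
structure FolnerNet (G : Type*) [Group G] where
  J : Type*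
  pre : Preorder J
  dir : IsDirected J fun a b => pre.le a b
  nonempty : Nonempty J
  F : J → Finset G
  F_nonempty : ∀ j, (F j).Nonempty
  folner : ∀ g : G,
    Filter.Tendsto (fun j => (((g • (F j : Set G)) \ (F j : Set G)).ncard : ℝ) / ((F j).card : ℝ))
      (@Filter.atTop J pre) (nhds 0)

/-- The action of `G` on the uniform space `X` is expansive. -/
def ExpansiveAction (G X : Type*) [SMul G X] [UniformSpace X] : Prop :=
  ∃ U₀ ∈ 𝓤 X, ∀ x y : X, x ≠ y → ∃ g : G, (g • x, g • y) ∉ U₀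

/-- Two points are homoclinic if their orbits are asymptotically close. -/
def Homoclinic (G : Type*) {X : Type*} [SMul G X] [UniformSpace X] (x y : X) : Prop :=
  ∀ U ∈ 𝓤 X, ∃ Ω : Finset G, ∀ g : G, g ∉ Ω → (g • x, g • y) ∈ U

/-- `Λ` is a specification subset for the entourage `U`:  any finite family of points
prescribed (up to `U`) on finite sets `Ω i` that are pairwise `Λ`-apart can be shadowed
by a single point. -/
def IsSpecificationSubset (G X : Type*) [Group G] [SMul G X]
    (U : Set (X × X)) (Λ : Finset G) : Prop :=
  ∀ (ι : Type) (_ : Finite ι) (_ : Nonempty ι) (Ω : ι → Finset G) (x : ι → X),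
    (∀ j k : ι, j ≠ k → Disjoint ((Ω j : Set G)) ((Λ : Set G) * (Ω k : Set G))) →
    ∃ y : X, ∀ i : ι, ∀ g ∈ Ω i, (g • y, g • x i) ∈ U

/-- The weak specification property for the action of `G` on the uniform space `X`. -/
def WeakSpecification (G X : Type*) [Group G] [SMul G X] [UniformSpace X] : Prop :=
  ∀ U ∈ 𝓤 X, ∃ Λ : Finset G, IsSpecificationSubset G X U Λ

section Separated

variable {G X : Type*}

/-- Distinct points of `S` are moved `V`-apart by some element of `E`. -/
def IsSeparatedOn [SMul G X] (E : Finset G) (V : Set (X × X)) (S : Finset X) : Prop :=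
  ∀ x ∈ S, ∀ y ∈ S, x ≠ y → ∃ g ∈ E, (g • x, g • y) ∉ V

lemma IsSeparatedOn.card_le [SMul G X] {κ : Type*} [Fintype κ] {c : X → κ}
    {V : Set (X × X)} (hc : ∀ x y, c x = c y → (x, y) ∈ V) {E : Finset G} {S : Finset X}
    (hS : IsSeparatedOn E V S) : S.card ≤ Fintype.card κ ^ E.card := by
  classical
  have h := Finset.card_le_card_of_injOn (s := S) (t := (Finset.univ : Finset (E → κ)))
    (fun x g => c ((g : G) • x)) (by simp) (by
      intro x hx y hy hxy
      by_contra hne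
      obtain ⟨g, hg, hgV⟩ := hS x hx y hy hne
      exact hgV (hc _ _ (congrFun hxy ⟨g, hg⟩)))
  simpa using h

lemma exists_isSeparatedOn_card_max [SMul G X] {κ : Type*} [Fintype κ] {c : X → κ}
    {V : Set (X × X)} (hc : ∀ x y, c x = c y → (x, y) ∈ V) (E : Finset G) :
    ∃ S : Finset X, IsSeparatedOn E V S ∧
      ∀ S' : Finset X, IsSeparatedOn E V S' → S'.card ≤ S.card := by
  obtain ⟨S, hS, hmax⟩ := Nat.sSup_mem
    (s := {n | ∃ S : Finset X, IsSeparatedOn E V S ∧ S.card = n})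
    ⟨0, ∅, by simp [IsSeparatedOn], rfl⟩
    ⟨_, by rintro n ⟨S, hS, rfl⟩; exact hS.card_le hc⟩
  refine ⟨S, hS, fun S' hS' => ?_⟩
  rw [hmax]
  exact le_csSup ⟨_, by rintro n ⟨S, hS, rfl⟩; exact hS.card_le hc⟩ ⟨S', hS', rfl⟩

lemma isSeparatedOn_image [SMul G X] [DecidableEq X] {V : Set (X × X)}
    (hrefl : ∀ x, (x, x) ∈ V) {E : Finset G} {ι : Type*} {s : Finset ι} {φ : ι → X}
    (h : ∀ i ∈ s, ∀ j ∈ s, i ≠ j → ∃ g ∈ E, (g • φ i, g • φ j) ∉ V) :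
    IsSeparatedOn E V (s.image φ) ∧ (s.image φ).card = s.card := by
  constructor
  · intro x hx y hy hxy
    obtain ⟨i, hi, rfl⟩ := Finset.mem_image.1 hx
    obtain ⟨j, hj, rfl⟩ := Finset.mem_image.1 hy
    exact h i hi j hj fun hij => hxy (congrArg φ hij)
  · refine Finset.card_image_of_injOn fun i hi j hj hij => ?_
    by_contra hne
    obtain ⟨g, -, hg⟩ := h i hi j hj hne
    exact hg (hij ▸ hrefl _)

lemma IsSeparatedOn.exists_subset [SMul G X] {κ : Type*} [Fintype κ] {c : X → κ}
    {U V : Set (X × X)} (hc : ∀ x y, c x = c y → (x, y) ∈ U) (hrefl : ∀ x, (x, x) ∈ V)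
    (hsymm : ∀ x y, (x, y) ∈ V → (y, x) ∈ V)
    (hcomp : ∀ x y z, (x, y) ∈ V → (y, z) ∈ V → (x, z) ∈ U)
    {D H B : Finset G} (hD : ∀ g ∈ D, g ∈ H ∨ g ∈ B) {S : Finset X} (hS : IsSeparatedOn D U S) :
    ∃ S' ⊆ S, IsSeparatedOn H V S' ∧ S.card ≤ S'.card * Fintype.card κ ^ B.card := by
  classical
  obtain ⟨S', hS', hmax⟩ := Finset.exists_max_image
    (S.powerset.filter fun S' => IsSeparatedOn H V S') Finset.card
    ⟨∅, Finset.mem_filter.2 ⟨Finset.empty_mem_powerset S, by simp [IsSeparatedOn]⟩⟩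
  simp only [Finset.mem_filter, Finset.mem_powerset] at hS' hmax
  obtain ⟨hsub, hsep⟩ := hS'
  refine ⟨S', hsub, hsep, ?_⟩
  have key : ∀ y, ∃ r, y ∈ S → r ∈ S' ∧ ∀ g ∈ H, (g • y, g • r) ∈ V := by
    intro y
    by_cases hy : y ∈ S; swap
    · exact ⟨y, fun h => absurd h hy⟩
    by_cases hy' : y ∈ S'
    · exact ⟨y, fun _ => ⟨hy', fun g _ => hrefl _⟩⟩
    by_contra! hcon
    have hfar : ∀ r ∈ S', ∃ g ∈ H, (g • y, g • r) ∉ V := fun r hr => (hcon r).2 hr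
    have h1 := hmax (insert y S') ⟨Finset.insert_subset hy hsub, by
      intro a ha b hb hab
      rcases Finset.mem_insert.1 ha with hay | ha
      · rcases Finset.mem_insert.1 hb with hby | hb
        · exact absurd (hay.trans hby.symm) hab
        · exact hay ▸ hfar b hb
      · rcases Finset.mem_insert.1 hb with hby | hb
        · obtain ⟨g, hg, hgV⟩ := hfar a ha
          subst hby
          exact ⟨g, hg, fun h => hgV (hsymm _ _ h)⟩
        · exact hsep a ha b hb hab⟩
    rw [Finset.card_insert_of_notMem hy'] at h1
    omega
  choose r hr using key
  have h := Finset.card_le_card_of_injOn (s := S)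
    (t := S' ×ˢ (Finset.univ : Finset (B → κ)))
    (fun x => (r x, fun g => c ((g : G) • x)))
    (fun x hx => by simpa using (hr x hx).1) (by
      intro x hx y hy hxy
      simp only [Prod.mk.injEq] at hxy
      by_contra hne
      obtain ⟨g, hg, hgU⟩ := hS x hx y hy hne
      rcases hD g hg with hg | hg
      · have h1 := (hr x hx).2 g hg
        have h2 := (hr y hy).2 g hg
        rw [hxy.1] at h1
        exact hgU (hcomp _ _ _ h1 (hsymm _ _ h2))
      · exact hgU (hc _ _ (congrFun hxy.2 ⟨g, hg⟩)))
  simpa [Finset.card_product] using h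

end Separated

section Entourages

lemma exists_closed_symm_comp_subset {X : Type*} [UniformSpace X] {U : Set (X × X)}
    (hU : U ∈ 𝓤 X) :
    ∃ Q ∈ 𝓤 X, IsClosed Q ∧ (∀ x y, (x, y) ∈ Q → (y, x) ∈ Q) ∧
      ∀ a b c d, (a, b) ∈ Q → (b, c) ∈ Q → (c, d) ∈ Q → (a, d) ∈ U := by
  obtain ⟨t, ht, -, htU⟩ := comp_comp_symm_mem_uniformity_sets hU
  obtain ⟨C, hC, hCc, hCt⟩ := mem_uniformity_isClosed ht
  refine ⟨C ∩ Prod.swap ⁻¹' C, inter_mem hC (tendsto_swap_uniformity hC),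
    hCc.inter (hCc.preimage continuous_swap), fun x y h => ⟨h.2, h.1⟩, ?_⟩
  intro a b c d hab hbc hcd
  exact htU ⟨c, ⟨b, hCt hab.1, hCt hbc.1⟩, hCt hcd.1⟩

lemma exists_finite_coloring {X : Type*} [UniformSpace X] [CompactSpace X] {U : Set (X × X)}
    (hU : U ∈ 𝓤 X) :
    ∃ (t : Finset X) (c : X → t), ∀ x y, c x = c y → (x, y) ∈ U := by
  obtain ⟨Q, hQ, -, hsymm, hcomp⟩ := exists_closed_symm_comp_subset hU
  obtain ⟨t, ht, hcov⟩ := (isCompact_univ (X := X)).totallyBounded Q hQ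
  have h : ∀ x : X, ∃ y : ht.toFinset, (x, (y : X)) ∈ Q := by
    intro x
    obtain ⟨y, hy, hxy⟩ := Set.mem_iUnion₂.1 (hcov (Set.mem_univ x))
    exact ⟨⟨y, by simpa using hy⟩, hxy⟩
  choose c hc using h
  refine ⟨ht.toFinset, c, fun x y hxy => ?_⟩
  have hx := hc x
  rw [hxy] at hx
  exact hcomp _ _ _ _ hx (refl_mem_uniformity hQ) (hsymm _ _ (hc y))

lemma exists_finset_forall_smul_mem_imp_mem {G X : Type*} [UniformSpace X] [CompactSpace X]
    [SMul G X]
    (hcont : ∀ g : G, Continuous fun x : X => g • x) {U₀ : Set (X × X)} (hcl : IsClosed U₀)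
    (hexp : ∀ x y : X, x ≠ y → ∃ g : G, (g • x, g • y) ∉ U₀) {V : Set (X × X)} (hV : V ∈ 𝓤 X) :
    ∃ K : Finset G, ∀ x y : X, (∀ k ∈ K, (k • x, k • y) ∈ U₀) → (x, y) ∈ V := by
  have hcomp : IsCompact (interior V)ᶜ := isOpen_interior.isClosed_compl.isCompact
  obtain ⟨K, hK⟩ := hcomp.elim_finite_subfamily_closed
    (fun g : G => {p : X × X | (g • p.1, g • p.2) ∈ U₀})
    (fun g => hcl.preimage
      (((hcont g).comp continuous_fst).prodMk ((hcont g).comp continuous_snd))) (by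
      rw [Set.eq_empty_iff_forall_notMem]
      rintro ⟨x, y⟩ ⟨hxV, hxy⟩
      have hxy' : x = y := by
        by_contra hne
        obtain ⟨g, hg⟩ := hexp x y hne
        exact hg (Set.mem_iInter.1 hxy g)
      subst hxy'
      exact hxV (refl_mem_uniformity (interior_mem_uniformity hV)))
  refine ⟨K, fun x y h => ?_⟩
  by_contra hn
  have : (x, y) ∈ (∅ : Set (X × X)) := hK ▸
    ⟨fun h => hn (interior_subset h), Set.mem_iInter₂.2 h⟩
  exact this

lemma homoclinic_of_forall_notMem {G X : Type*} [UniformSpace X] [CompactSpace X]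
    [Group G] [MulAction G X]
    (hcont : ∀ g : G, Continuous fun x : X => g • x) {U₀ : Set (X × X)} (hcl : IsClosed U₀)
    (hexp : ∀ x y : X, x ≠ y → ∃ g : G, (g • x, g • y) ∉ U₀) {x y : X} {D : Finset G}
    (h : ∀ g ∉ D, (g • x, g • y) ∈ U₀) : Homoclinic G x y := by
  classical
  intro V hV
  obtain ⟨K, hK⟩ := exists_finset_forall_smul_mem_imp_mem hcont hcl hexp hV
  refine ⟨K⁻¹ * D, fun g hg => hK _ _ fun k hk => ?_⟩
  rw [smul_smul, smul_smul]
  refine h _ fun hkg => hg ?_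
  simpa using Finset.mul_mem_mul (Finset.inv_mem_inv hk) hkg

lemma IsSeparatedOn.of_forall_smul_mem_imp_mem {G X : Type*} [Group G] [MulAction G X]
    [DecidableEq G]
    {U₀ V : Set (X × X)} {K : Finset G}
    (hK : ∀ x y : X, (∀ k ∈ K, (k • x, k • y) ∈ U₀) → (x, y) ∈ V) {D : Finset G} {S : Finset X}
    (hS : IsSeparatedOn D V S) : IsSeparatedOn (K * D) U₀ S := by
  intro x hx y hy hxy
  obtain ⟨g, hg, hgV⟩ := hS x hx y hy hxy
  by_contra! hcon
  refine hgV (hK _ _ fun k hk => ?_)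
  rw [smul_smul, smul_smul]
  exact hcon _ (Finset.mul_mem_mul hk hg)

end Entourages

section Specification

variable {G X : Type*} [Group G]

lemma IsSpecificationSubset.exists_shadow [SMul G X] {U : Set (X × X)} {Λ : Finset G}
    (h : IsSpecificationSubset G X U Λ) {ι : Type*} [Finite ι] [Nonempty ι]
    (Ω : ι → Finset G) (x : ι → X)
    (hΩ : ∀ j k : ι, j ≠ k → ∀ l ∈ Λ, ∀ g ∈ Ω k, l * g ∉ Ω j) :
    ∃ y : X, ∀ i : ι, ∀ g ∈ Ω i, (g • y, g • x i) ∈ U := by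
  obtain ⟨n, ⟨e⟩⟩ := Finite.exists_equiv_fin ι
  obtain ⟨y, hy⟩ := h (Fin n) inferInstance (e.symm.nonempty_congr.2 inferInstance)
    (Ω ∘ e.symm) (x ∘ e.symm) (by
      intro j k hjk
      rw [Set.disjoint_left]
      rintro a ha ⟨l, hl, g, hg, rfl⟩
      exact hΩ (e.symm j) (e.symm k) (by simpa using hjk) l hl g hg ha)
  exact ⟨y, fun i g hg => by simpa using hy (e i) g (by simpa using hg)⟩

lemma IsSpecificationSubset.exists_copy [DecidableEq G] [UniformSpace X] [CompactSpace X]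
    [MulAction G X]
    (hcont : ∀ g : G, Continuous fun x : X => g • x) {Q : Set (X × X)} (hcl : IsClosed Q)
    {Λ E : Finset G} (h : IsSpecificationSubset G X Q Λ) (hE : ∀ l ∈ Λ, l ∈ E)
    (hE' : ∀ l ∈ Λ, l⁻¹ ∈ E) (F : Finset G) (x x₀ : X) :
    ∃ y : X, (∀ g ∈ F, (g • y, g • x) ∈ Q) ∧ ∀ g ∉ E * F, (g • y, g • x₀) ∈ Q := by
  have hclosed : ∀ (g : G) (a : X), IsClosed {y : X | (g • y, a) ∈ Q} := fun g a =>
    hcl.preimage ((hcont g).prodMk continuous_const)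
  have hcompact : IsCompact {y : X | ∀ g ∈ F, (g • y, g • x) ∈ Q} := by
    apply IsClosed.isCompact
    simp only [Set.ofPred_forall]
    exact isClosed_biInter fun g _ => hclosed g _
  obtain ⟨y, hy, hy'⟩ := hcompact.inter_iInter_nonempty
    (fun g : {g : G // g ∉ E * F} => {y : X | ((g : G) • y, (g : G) • x₀) ∈ Q})
    (fun g => hclosed g _) (by
      intro u
      obtain ⟨y, hy⟩ := h.exists_shadow
        (fun b : Bool => if b then F else u.map (Function.Embedding.subtype _))
        (fun b => if b then x else x₀) (by
          rintro (_ | _) (_ | _) hjk l hl g hg hlg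
          · exact hjk rfl
          · simp only [if_true, Bool.false_eq_true, if_false, Finset.mem_map,
              Function.Embedding.coe_subtype] at hg hlg
            obtain ⟨a, -, ha⟩ := hlg
            exact a.2 (ha ▸ Finset.mul_mem_mul (hE l hl) hg)
          · simp only [if_true, Bool.false_eq_true, if_false, Finset.mem_map,
              Function.Embedding.coe_subtype] at hg hlg
            obtain ⟨a, -, rfl⟩ := hg
            exact a.2 (by simpa using Finset.mul_mem_mul (hE' l hl) hlg)
          · exact hjk rfl)
      refine ⟨y, fun g hg => by simpa using hy true g (by simpa using hg),
        Set.mem_iInter₂.2 fun g hg => ?_⟩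
      simpa using hy false g (by simpa using ⟨g.2, hg⟩))
  exact ⟨y, hy, fun g hg => Set.mem_iInter.1 hy' ⟨g, hg⟩⟩

end Specification

section Folner

variable {G : Type*} [Group G]

lemma FolnerNet.exists_finset_mul_card_sdiff_lt [DecidableEq G] (N : FolnerNet G)
    (P : Finset G) (n : ℕ) : ∃ F : Finset G, F.Nonempty ∧ n * ((P * F) \ F).card < F.card := by
  let _ := N.pre
  have := N.dir
  have := N.nonempty
  have hsum := tendsto_finsetSum P fun g _ => N.folner g
  have hev := hsum.eventually_lt_const (u := 1 / (n + 1 : ℝ)) (by simp; positivity)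
  obtain ⟨j, hj⟩ := hev.exists
  refine ⟨N.F j, N.F_nonempty j, ?_⟩
  have hpos : (0 : ℝ) < (N.F j).card := by exact_mod_cast (N.F_nonempty j).card_pos
  rw [← Finset.sum_div, div_lt_div_iff₀ hpos (by positivity), one_mul] at hj
  have hcard : ((P * N.F j) \ N.F j).card ≤
      ∑ g ∈ P, ((g • (N.F j : Set G)) \ (N.F j : Set G)).ncard := by
    have hsub : (P * N.F j) \ N.F j ⊆ P.biUnion fun g => (g • N.F j) \ N.F j := by
      intro a ha
      obtain ⟨ha, haF⟩ := Finset.mem_sdiff.1 ha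
      obtain ⟨p, hp, f, hf, rfl⟩ := Finset.mem_mul.1 ha
      exact Finset.mem_biUnion.2
        ⟨p, hp, Finset.mem_sdiff.2 ⟨Finset.smul_mem_smul_finset hf, haF⟩⟩
    refine (Finset.card_le_card hsub).trans (Finset.card_biUnion_le.trans (le_of_eq ?_))
    refine Finset.sum_congr rfl fun g _ => ?_
    rw [← Set.ncard_coe_finset]
    simp
  have hcard' : (((P * N.F j) \ N.F j).card : ℝ) ≤
      ∑ g ∈ P, (((g • (N.F j : Set G)) \ (N.F j : Set G)).ncard : ℝ) := by exact_mod_cast hcard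
  have : (((n + 1) * ((P * N.F j) \ N.F j).card : ℕ) : ℝ) < (N.F j).card := by
    push_cast
    nlinarith
  have : (n + 1) * ((P * N.F j) \ N.F j).card < (N.F j).card := by exact_mod_cast this
  nlinarith

/-- A maximal `E`-discrete subset of `F` is `E`-dense in `F`. -/
lemma exists_discrete_subset [DecidableEq G] {E : Finset G} (h1 : 1 ∈ E)
    (hinv : ∀ g ∈ E, g⁻¹ ∈ E) (F : Finset G) :
    ∃ T ⊆ F, (∀ t ∈ T, ∀ e ∈ E, e * t ∈ T → e * t = t) ∧ F.card ≤ E.card * T.card := by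
  obtain ⟨T, hT, hmax⟩ := Finset.exists_max_image
    (F.powerset.filter fun T => ∀ t ∈ T, ∀ e ∈ E, e * t ∈ T → e * t = t) Finset.card
    ⟨∅, by simp⟩
  simp only [Finset.mem_filter, Finset.mem_powerset] at hT hmax
  obtain ⟨hTF, hT⟩ := hT
  refine ⟨T, hTF, hT, (Finset.card_le_card ?_).trans Finset.card_mul_le⟩
  intro a ha
  by_contra hcon
  have haT : a ∉ T := fun h => hcon (by simpa using Finset.mul_mem_mul h1 h)
  have h2 := hmax (insert a T) ⟨Finset.insert_subset ha hTF, by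
    intro t ht e he het
    rcases Finset.mem_insert.1 ht with rfl | ht
    · rcases Finset.mem_insert.1 het with h | h
      · exact h
      · exact absurd (by simpa using Finset.mul_mem_mul (hinv e he) h) hcon
    · rcases Finset.mem_insert.1 het with h | h
      · exact absurd (h ▸ Finset.mul_mem_mul he ht) hcon
      · exact hT t ht e he h⟩
  rw [Finset.card_insert_of_notMem haT] at h2
  omega

end Folner

/-- If the points of `S` stay `W`-far from `z`, then independently inserting `z` at the positions
of a discrete set `T` makes the number of separated points grow exponentially in `|T|`. -/
lemma IsSeparatedOn.exists_exponential_growth {G X : Type*} [Group G] [MulAction G X]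
    [DecidableEq G] {κ : Type*} [Fintype κ] [Nonempty κ] {c : X → κ} {U V W Q : Set (X × X)}
    (hc : ∀ x y, c x = c y → (x, y) ∈ U) (hVrefl : ∀ x, (x, x) ∈ V)
    (hVsymm : ∀ x y, (x, y) ∈ V → (y, x) ∈ V)
    (hVcomp : ∀ x y z, (x, y) ∈ V → (y, z) ∈ V → (x, z) ∈ U)
    (hQrefl : ∀ x, (x, x) ∈ Q) (hQsymm : ∀ x y, (x, y) ∈ Q → (y, x) ∈ Q)
    (hQcomp : ∀ a b c d, (a, b) ∈ Q → (b, c) ∈ Q → (c, d) ∈ Q → (a, d) ∈ V ∩ W)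
    {Λ E : Finset G} (hΛ : IsSpecificationSubset G X Q Λ) (hE : ∀ l ∈ Λ, l ∈ E)
    (hinv : ∀ g ∈ E, g⁻¹ ∈ E) {D T : Finset G} (hTD : T ⊆ D)
    (hT : ∀ t ∈ T, ∀ e ∈ E, e * t ∈ T → e * t = t) {S : Finset X} (hS : IsSeparatedOn D U S)
    {z : X} (hz : ∀ y ∈ S, ∀ g : G, (g • y, z) ∉ W) :
    ∃ S' : Finset X, IsSeparatedOn D Q S' ∧
      S.card * (Fintype.card κ ^ E.card + 1) ^ T.card ≤
        S'.card * (Fintype.card κ ^ E.card) ^ T.card := by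
  classical
  have hthin : ∀ I : Finset G, ∃ S' ⊆ S, IsSeparatedOn (D \ (E * I)) V S' ∧
      S.card ≤ S'.card * Fintype.card κ ^ (E * I).card := fun I =>
    hS.exists_subset hc hVrefl hVsymm hVcomp (fun g hg => by
      by_cases h : g ∈ E * I
      · exact Or.inr h
      · exact Or.inl (Finset.mem_sdiff.2 ⟨hg, h⟩))
  choose R hRS hRsep hRcard using hthin
  have hshadow : ∀ (I : Finset G) (y : X), ∃ w : X, I ⊆ T →
      (∀ g ∈ D \ (E * I), (g • w, g • y) ∈ Q) ∧ ∀ t ∈ I, (t • w, z) ∈ Q := by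
    intro I y
    by_cases hI : I ⊆ T; swap
    · exact ⟨y, fun h => absurd h hI⟩
    obtain ⟨w, hw⟩ := hΛ.exists_shadow (ι := Option I)
      (fun o => o.elim (D \ (E * I)) fun t => {(t : G)})
      (fun o => o.elim y fun t => (t : G)⁻¹ • z) (by
        rintro (_ | t) (_ | t') hjk l hl g hg hlg
        · exact hjk rfl
        · simp only [Option.elim_some, Option.elim_none, Finset.mem_singleton] at hg hlg
          subst hg
          exact (Finset.mem_sdiff.1 hlg).2 (Finset.mul_mem_mul (hE l hl) t'.2)
        · simp only [Option.elim_some, Option.elim_none, Finset.mem_singleton] at hg hlg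
          refine (Finset.mem_sdiff.1 hg).2 ?_
          simpa [← hlg] using Finset.mul_mem_mul (hinv l (hE l hl)) t.2
        · simp only [Option.elim_some, Finset.mem_singleton] at hg hlg
          subst hg
          refine hjk (congrArg some (Subtype.ext ?_))
          rw [← hlg]
          exact hT _ (hI t'.2) l (hE l hl) (hlg ▸ hI t.2))
    refine ⟨w, fun _ => ⟨fun g hg => hw none g hg, fun t ht => ?_⟩⟩
    simpa using hw (some ⟨t, ht⟩) t (by simp)
  choose w hw using hshadow
  have hfresh : ∀ I ⊆ T, ∀ J ⊆ T, ∀ x ∈ S, ∀ y ∈ S, ∀ t ∈ I, t ∉ J →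
      (t • w I x, t • w J y) ∉ Q := by
    intro I hI J hJ x hx y hy t htI htJ hQ
    have ht : t ∈ D \ (E * J) := by
      refine Finset.mem_sdiff.2 ⟨hTD (hI htI), fun h => htJ ?_⟩
      obtain ⟨e, he, j, hj, rfl⟩ := Finset.mem_mul.1 h
      rwa [hT j (hJ hj) e he (hI htI)]
    exact hz y hy t (hQcomp _ _ _ _ (hQsymm _ _ ((hw J y hJ).1 t ht)) (hQsymm _ _ hQ)
      ((hw I x hI).2 t htI)).2
  obtain ⟨hsep, hcard⟩ := isSeparatedOn_image (E := D) hQrefl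
    (s := T.powerset.sigma R) (φ := fun p => w p.1 p.2) (by
      rintro ⟨I, x⟩ hIx ⟨J, y⟩ hJy hne
      simp only [Finset.mem_sigma, Finset.mem_powerset] at hIx hJy
      obtain ⟨hI, hx⟩ := hIx
      obtain ⟨hJ, hy⟩ := hJy
      by_cases hIJ : I = J
      · subst hIJ
        obtain ⟨g, hg, hgV⟩ := hRsep I x hx y hy fun h => hne (by rw [h])
        exact ⟨g, (Finset.mem_sdiff.1 hg).1, fun hQ => hgV (hQcomp _ _ _ _
          (hQsymm _ _ ((hw I x hI).1 g hg)) hQ ((hw I y hI).1 g hg)).1⟩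
      · by_cases hsub : I ⊆ J
        · obtain ⟨t, htJ, htI⟩ := Finset.not_subset.1 fun h => hIJ (hsub.antisymm h)
          exact ⟨t, hTD (hJ htJ), fun hQ =>
            hfresh J hJ I hI y (hRS J hy) x (hRS I hx) t htJ htI (hQsymm _ _ hQ)⟩
        · obtain ⟨t, htI, htJ⟩ := Finset.not_subset.1 hsub
          exact ⟨t, hTD (hI htI), hfresh I hI J hJ x (hRS I hx) y (hRS J hy) t htI htJ⟩)
  refine ⟨_, hsep, ?_⟩
  rw [hcard, Finset.card_sigma, add_comm, ← Finset.sum_pow_mul_eq_add_pow, Finset.mul_sum,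
    Finset.sum_mul]
  refine Finset.sum_le_sum fun I hI => ?_
  have hIT := Finset.card_le_card (Finset.mem_powerset.1 hI)
  have hRI : S.card ≤ (R I).card * (Fintype.card κ ^ E.card) ^ I.card := by
    rw [← pow_mul]
    exact (hRcard I).trans
      (Nat.mul_le_mul_left _ (Nat.pow_le_pow_right Fintype.card_pos Finset.card_mul_le))
  calc S.card * (1 ^ I.card * (Fintype.card κ ^ E.card) ^ (T.card - I.card))
      ≤ ((R I).card * (Fintype.card κ ^ E.card) ^ I.card) *
          (Fintype.card κ ^ E.card) ^ (T.card - I.card) := by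
        rw [one_pow, one_mul]
        exact Nat.mul_le_mul_right _ hRI
    _ = (R I).card * (Fintype.card κ ^ E.card) ^ T.card := by
        rw [mul_assoc, ← pow_add, Nat.add_sub_cancel' hIT]

lemma exists_forall_le_mul_of_succ_pow_le (A : ℕ) {C : ℕ} (hC : 0 < C) :
    ∃ n : ℕ, ∀ m b : ℕ, (C + 1) ^ m ≤ A ^ b * C ^ m → m ≤ n * b := by
  have hC' : (0 : ℝ) < C := by exact_mod_cast hC
  have hq : 1 < ((C : ℝ) + 1) / C := by rw [one_lt_div hC']; linarith
  obtain ⟨n, hn⟩ := pow_unbounded_of_one_lt (A : ℝ) hq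
  refine ⟨n, fun m b h => ?_⟩
  have h' : ((C : ℝ) + 1) ^ m ≤ A ^ b * C ^ m := by exact_mod_cast h
  have h1 : (((C : ℝ) + 1) / C) ^ m ≤ (((C : ℝ) + 1) / C) ^ (n * b) :=
    calc (((C : ℝ) + 1) / C) ^ m ≤ (A : ℝ) ^ b := by
          rwa [div_pow, div_le_iff₀ (pow_pos hC' m)]
      _ ≤ ((((C : ℝ) + 1) / C) ^ n) ^ b := by gcongr
      _ = _ := (pow_mul _ _ _).symm
  exact (pow_le_pow_iff_right₀ hq).1 h1

/-- A pre-injective equivariant map sends suitable homoclinic copies of an `(F, V)`-separated set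
to a set of the same size separated on a thickening of `F`. -/
lemma exists_isSeparatedOn_range_of_preinjective {G X : Type*} [Group G] [UniformSpace X]
    [CompactSpace X] [MulAction G X] [DecidableEq G]
    (hcont : ∀ g : G, Continuous fun x : X => g • x) {U V Q : Set (X × X)}
    (hU : U ∈ 𝓤 X) (hUcl : IsClosed U) (hexp : ∀ x y : X, x ≠ y → ∃ g : G, (g • x, g • y) ∉ U)
    (hQ : Q ∈ 𝓤 X) (hQcl : IsClosed Q) (hQsymm : ∀ x y, (x, y) ∈ Q → (y, x) ∈ Q)
    (hQcomp : ∀ a b c d, (a, b) ∈ Q → (b, c) ∈ Q → (c, d) ∈ Q → (a, d) ∈ V) (hVU : V ⊆ U)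
    {Λ E : Finset G} (hΛ : IsSpecificationSubset G X Q Λ) (hE : ∀ l ∈ Λ, l ∈ E)
    (hinv : ∀ g ∈ E, g⁻¹ ∈ E) {f : X → X} {L : Finset G}
    (hequiv : ∀ (g : G) (x : X), f (g • x) = g • f x)
    (hL : ∀ x y : X, (∀ k ∈ L, (k • x, k • y) ∈ U) → (f x, f y) ∈ U)
    (hpre : ∀ x y : X, Homoclinic G x y → f x = f y → x = y)
    {F : Finset G} {S : Finset X} (hS : IsSeparatedOn F V S) (x₀ : X) :
    ∃ S' : Finset X, ↑S' ⊆ Set.range f ∧ IsSeparatedOn (L⁻¹ * E * F) U S' ∧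
      S'.card = S.card := by
  classical
  choose w hw hw' using fun x => hΛ.exists_copy hcont hQcl hE (fun l hl => hinv l (hE l hl)) F x x₀
  have hout : ∀ x y, ∀ g ∉ E * F, (g • w x, g • w y) ∈ U := fun x y g hg =>
    hVU (hQcomp _ _ _ _ (hw' x g hg) (hQsymm _ _ (hw' y g hg)) (refl_mem_uniformity hQ))
  obtain ⟨hsep, hcard⟩ := isSeparatedOn_image (E := L⁻¹ * E * F)
    (fun x => refl_mem_uniformity hU) (s := S) (φ := f ∘ w) (by
      intro x hx y hy hxy
      obtain ⟨g, hg, hgV⟩ := hS x hx y hy hxy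
      have hne : w x ≠ w y := fun h => hgV (hQcomp _ _ _ _ (hQsymm _ _ (hw x g hg))
        (refl_mem_uniformity hQ) (h ▸ hw y g hg))
      obtain ⟨g, hg⟩ := hexp (f (w x)) (f (w y)) fun h =>
        hne (hpre _ _ (homoclinic_of_forall_notMem hcont hUcl hexp (hout x y)) h)
      refine ⟨g, ?_, hg⟩
      by_contra hgD
      refine hg ?_
      rw [← hequiv, ← hequiv]
      refine hL _ _ fun k hk => ?_
      rw [smul_smul, smul_smul]
      refine hout x y _ fun hkg => hgD ?_
      rw [mul_assoc]
      simpa using Finset.mul_mem_mul (Finset.inv_mem_inv hk) hkg)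
  refine ⟨S.image (f ∘ w), ?_, hsep, hcard⟩
  intro y hy
  obtain ⟨x, -, rfl⟩ := Finset.mem_image.1 (Finset.mem_coe.1 hy)
  exact Set.mem_range_self _

/-- Every expansive continuous action with the weak specification property of an amenable
group on a compact Hausdorff space has the Myhill property: every pre-injective continuous
equivariant self-map is surjective. -/
theorem myhill_property {G X : Type*} [Group G] [UniformSpace X] [CompactSpace X] [T2Space X]
    [MulAction G X] (hcont : ∀ g : G, Continuous fun x : X => g • x)
    (hamen : Nonempty (FolnerNet G))
    (hexp : ExpansiveAction G X) (hwsp : WeakSpecification G X)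
    (f : X → X) (hf : Continuous f) (hequiv : ∀ (g : G) (x : X), f (g • x) = g • f x)
    (hpre : ∀ x y : X, Homoclinic G x y → f x = f y → x = y) :
    Function.Surjective f := by
  classical
  intro z
  by_contra hz
  change z ∉ Set.range f at hz
  obtain ⟨N⟩ := hamen
  obtain ⟨U', hU', hexp'⟩ := hexp
  obtain ⟨U, hU, hUcl, hUU'⟩ := mem_uniformity_isClosed hU'
  have hexpU : ∀ x y : X, x ≠ y → ∃ g : G, (g • x, g • y) ∉ U := fun x y hxy =>
    (hexp' x y hxy).imp fun g hg h => hg (hUU' h)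
  obtain ⟨W, hW, hWf⟩ : ∃ W ∈ 𝓤 X, ∀ x, (f x, z) ∉ W :=
    ⟨_, mem_nhds_uniformity_iff_left.1
      ((isCompact_range hf).isClosed.isOpen_compl.mem_nhds hz), fun x h => h rfl ⟨x, rfl⟩⟩
  obtain ⟨V, hV, -, hVsymm, hVcomp'⟩ := exists_closed_symm_comp_subset hU
  have hVrefl : ∀ x, (x, x) ∈ V := fun x => refl_mem_uniformity hV
  have hVcomp : ∀ x y z, (x, y) ∈ V → (y, z) ∈ V → (x, z) ∈ U := fun x y z hxy hyz =>
    hVcomp' _ _ _ _ hxy hyz (hVrefl z)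
  have hVU : V ⊆ U := fun p hp => hVcomp _ _ _ hp (hVrefl _)
  obtain ⟨Q, hQ, hQcl, hQsymm, hQcomp⟩ := exists_closed_symm_comp_subset (inter_mem hV hW)
  obtain ⟨κ, c, hcV⟩ := exists_finite_coloring hV
  have hcU : ∀ x y, c x = c y → (x, y) ∈ U := fun x y h => hVU (hcV x y h)
  have : Nonempty κ := ⟨c z⟩
  obtain ⟨Λ, hΛ⟩ := hwsp Q hQ
  obtain ⟨K, hK⟩ := exists_finset_forall_smul_mem_imp_mem hcont hUcl hexpU hQ
  obtain ⟨L₀, hL₀⟩ := exists_finset_forall_smul_mem_imp_mem hcont hUcl hexpU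
    (CompactSpace.uniformContinuous_of_continuous hf hU)
  obtain ⟨E, hE⟩ : ∃ E : Finset G, E = insert 1 (Λ ∪ Λ⁻¹) := ⟨_, rfl⟩
  obtain ⟨L, hL⟩ : ∃ L : Finset G, L = insert 1 L₀ := ⟨_, rfl⟩
  have h1E : 1 ∈ E := by simp [hE]
  have hΛE : ∀ l ∈ Λ, l ∈ E := fun l hl => by simp [hE, hl]
  have hinv : ∀ g ∈ E, g⁻¹ ∈ E := by
    intro g hg
    simp only [hE, Finset.mem_insert, Finset.mem_union, Finset.mem_inv'] at hg ⊢
    rcases hg with rfl | hg | hg <;> simp_all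
  obtain ⟨n, hn⟩ := exists_forall_le_mul_of_succ_pow_le (Fintype.card κ)
    (pow_pos (Fintype.card_pos (α := κ)) E.card)
  obtain ⟨F, hF, hFn⟩ := N.exists_finset_mul_card_sdiff_lt (K * (L⁻¹ * E)) (E.card * n)
  obtain ⟨T, hTF, hT, hTcard⟩ := exists_discrete_subset h1E hinv F
  obtain ⟨S₀, hS₀, hmax⟩ := exists_isSeparatedOn_card_max hcV F
  have hS₀pos : 0 < S₀.card := by
    have := hmax {z} (by simp [IsSeparatedOn])
    simpa using this
  obtain ⟨S, hSf, hS, hScard⟩ := exists_isSeparatedOn_range_of_preinjective hcont hU hUcl hexpU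
    hQ hQcl hQsymm (fun a b c d h₁ h₂ h₃ => (hQcomp a b c d h₁ h₂ h₃).1) hVU hΛ hΛE hinv hequiv
    (L := L) (fun x y h => hL₀ x y fun k hk => h k (by simp [hL, hk])) hpre hS₀ z
  have hFD : F ⊆ L⁻¹ * E * F := fun g hg => by
    have h1L : (1 : G) ∈ L⁻¹ := by simp [hL]
    simpa using Finset.mul_mem_mul (Finset.mul_mem_mul h1L h1E) hg
  obtain ⟨S', hS', hS'card⟩ := hS.exists_exponential_growth hcU hVrefl hVsymm hVcomp
    (fun x => refl_mem_uniformity hQ) hQsymm hQcomp hΛ hΛE hinv (hTF.trans hFD) hT (z := z) (by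
      intro y hy g
      obtain ⟨x, rfl⟩ := hSf hy
      rw [← hequiv]
      exact hWf _)
  have hS'U := hS'.of_forall_smul_mem_imp_mem hK
  rw [← mul_assoc] at hS'U
  obtain ⟨R, -, hR, hRcard⟩ := hS'U.exists_subset hcU hVrefl hVsymm hVcomp
    (H := F) (B := (K * (L⁻¹ * E) * F) \ F) (fun g hg => by
      by_cases h : g ∈ F
      · exact Or.inl h
      · exact Or.inr (Finset.mem_sdiff.2 ⟨hg, h⟩))
  have hcount := hn T.card ((K * (L⁻¹ * E) * F) \ F).card (by
    refine Nat.le_of_mul_le_mul_left ?_ hS₀pos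
    rw [← mul_assoc]
    rw [hScard] at hS'card
    exact hS'card.trans (Nat.mul_le_mul_right _
      (hRcard.trans (Nat.mul_le_mul_right _ (hmax R hR)))))
  have := Nat.mul_le_mul_left E.card hcount
  rw [← mul_assoc] at this
  omega
end

section
/- Let X be a compact Hausdorff space equipped with a continuous action of a group G having the weak specification property. Let U be a closed entourage of X and let Λ ⊂ G be a specification subset for (X,G,U). Let (Ω_i)_{i∈I} be a possibly infinite family of possibly infinite subsets of G such that Ω_j ∩ ΛΩ_k = ∅ for all distinct j,k ∈ I, and let (x_i)_{i∈I} be a family of points of X. Then there exists a point x ∈ X such that (g·x, g·x_i) ∈ U for all g ∈ Ω_i and all i ∈ I. -/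
open scoped Pointwise Uniformity

/-- For a continuous action with weak specification on a compact Hausdorff space,
a specification subset `Λ` for a closed entourage `U` works for arbitrary (possibly
infinite) families of (possibly infinite) pairwise `Λ`-apart subsets of `G`. -/
theorem weakSpecification_infinite {G X : Type*} [Group G]
    [UniformSpace X] [CompactSpace X] [T2Space X] [MulAction G X]
    (hcont : ∀ g : G, Continuous fun x : X => g • x)
    (hwsp : WeakSpecification G X)
    (U : Set (X × X)) (hU : U ∈ 𝓤 X) (hUclosed : IsClosed U)
    (Λ : Finset G) (hΛ : IsSpecificationSubset G X U Λ)
    {ι : Type*} [Nonempty ι] (Ω : ι → Set G)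
    (hdisj : ∀ j k : ι, j ≠ k → Disjoint (Ω j) ((Λ : Set G) * Ω k))
    (x : ι → X) :
    ∃ y : X, ∀ i : ι, ∀ g ∈ Ω i, (g • y, g • x i) ∈ U := by
  classical
  obtain ⟨i₀⟩ := ‹Nonempty ι›
  let K : (Σ i, Ω i) → Set X := fun p => {y | ((p.2 : G) • y, (p.2 : G) • x p.1) ∈ U}
  have hK : ∀ p, IsClosed (K p) := fun p =>
    hUclosed.preimage ((hcont p.2).prodMk continuous_const)
  suffices h : (⋂ p, K p).Nonempty by
    obtain ⟨y, hy⟩ := h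
    exact ⟨y, fun i g hg => Set.mem_iInter.1 hy ⟨i, g, hg⟩⟩
  refine CompactSpace.iInter_nonempty hK fun t => ?_
  rcases t.eq_empty_or_nonempty with rfl | ht
  · exact ⟨x i₀, by simp⟩
  let J : Finset ι := t.image Sigma.fst
  have hJ : J.Nonempty := ht.image _
  let e : J ≃ Fin J.card := J.equivFin
  let Ω' : Fin J.card → Finset G := fun k =>
    (t.filter fun p => p.1 = (e.symm k : ι)).image fun p => (p.2 : G)
  have hΩ' : ∀ k, (Ω' k : Set G) ⊆ Ω (e.symm k) := by
    intro k g hg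
    obtain ⟨⟨i, h, hh⟩, hp, rfl⟩ := Finset.mem_image.1 (Finset.mem_coe.1 hg)
    have hi : i = (e.symm k : ι) := (Finset.mem_filter.1 hp).2
    exact hi ▸ hh
  obtain ⟨y, hy⟩ := hΛ (Fin J.card) inferInstance ⟨e ⟨_, hJ.choose_spec⟩⟩ Ω'
    (fun k => x (e.symm k)) fun j k hjk =>
      (hdisj _ _ fun h => hjk (e.symm.injective (Subtype.ext h))).mono (hΩ' j)
        (Set.mul_subset_mul_left (hΩ' k))
  refine ⟨y, Set.mem_iInter₂.2 fun p hp => ?_⟩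
  have hpJ : p.1 ∈ J := Finset.mem_image_of_mem _ hp
  have h := hy (e ⟨p.1, hpJ⟩) p.2
    (Finset.mem_image.2 ⟨p, Finset.mem_filter.2 ⟨hp, by simp⟩, rfl⟩)
  simpa [K] using h
end
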